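/- arXiv:2605.12244 — 2 statements merged into one kernel-verified Lean document; each statement's English description precedes it below -/
import Mathlib

section
/- Let T > 0 and let φ₁, φ₂ : ℝ → ℝ be smooth functions such that all iterated derivatives of φ₁ and φ₂ vanish at 0 up to orders q₁ − 1 and q₂ − 1 respectively (φⱼ^(i)(0) = 0 for i < qⱼ). Suppose i₁ is the least index with φ₁^(i₁)(T) ≠ 0 and i₂ is the least index with φ₂^(i₂)(T) ≠ 0. Then the product φ₁·φ₂ satisfies: (φ₁·φ₂)^(i)(0) = 0 for all i < q₁ + q₂, and (φ₁·φ₂)^(i₁+i₂)(T) = C(i₁+i₂, i₁)·φ₁^(i₁)(T)·φ₂^(i₂)(T) ≠ 0, where C(n,k) is the binomial coefficient. (The product of two left modulating functions is a left modulating function, part of Theorem 2.) -/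
/-- The product of two left modulating functions is a left modulating function
(part of Theorem 2). -/
theorem product_of_LMFs_is_LMF
    (T : ℝ) (hT : 0 < T) (φ₁ φ₂ : ℝ → ℝ)
    (h1 : ContDiff ℝ (⊤ : ℕ∞) φ₁) (h2 : ContDiff ℝ (⊤ : ℕ∞) φ₂)
    (q₁ q₂ i₁ i₂ : ℕ)
    (h1L : ∀ i < q₁, iteratedDeriv i φ₁ 0 = 0)
    (h2L : ∀ i < q₂, iteratedDeriv i φ₂ 0 = 0)
    (h1T : iteratedDeriv i₁ φ₁ T ≠ 0) (h1T' : ∀ i < i₁, iteratedDeriv i φ₁ T = 0)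
    (h2T : iteratedDeriv i₂ φ₂ T ≠ 0) (h2T' : ∀ i < i₂, iteratedDeriv i φ₂ T = 0) :
    (∀ i < q₁ + q₂, iteratedDeriv i (fun τ => φ₁ τ * φ₂ τ) 0 = 0) ∧
    iteratedDeriv (i₁ + i₂) (fun τ => φ₁ τ * φ₂ τ) T
      = ((i₁ + i₂).choose i₁ : ℝ) * iteratedDeriv i₁ φ₁ T * iteratedDeriv i₂ φ₂ T ∧
    iteratedDeriv (i₁ + i₂) (fun τ => φ₁ τ * φ₂ τ) T ≠ 0 := by
  have key : ∀ (n : ℕ) (x : ℝ), iteratedDeriv n (fun τ => φ₁ τ * φ₂ τ) x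
      = ∑ i ∈ Finset.range (n + 1),
        (n.choose i : ℝ) * iteratedDeriv i φ₁ x * iteratedDeriv (n - i) φ₂ x := by
    intro n x
    have hn : ((n : ℕ) : WithTop ℕ∞) ≤ ((⊤ : ℕ∞) : WithTop ℕ∞) := by
      exact_mod_cast (le_top : (n : ℕ∞) ≤ ⊤)
    exact iteratedDeriv_mul (h1.of_le hn).contDiffAt (h2.of_le hn).contDiffAt
  have hE : iteratedDeriv (i₁ + i₂) (fun τ => φ₁ τ * φ₂ τ) T
      = ((i₁ + i₂).choose i₁ : ℝ) * iteratedDeriv i₁ φ₁ T * iteratedDeriv i₂ φ₂ T := by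
    rw [key, Finset.sum_eq_single i₁]
    · rw [Nat.add_sub_cancel_left]
    · intro b hb hne
      rw [Finset.mem_range] at hb
      rcases lt_or_gt_of_ne hne with h | h
      · rw [h1T' b h]; ring
      · rw [h2T' (i₁ + i₂ - b) (by omega)]; ring
    · intro h
      exact absurd (Finset.mem_range.mpr (by omega)) h
  refine ⟨?_, hE, ?_⟩
  · intro i hi
    rw [key]
    refine Finset.sum_eq_zero fun b hb => ?_
    rw [Finset.mem_range] at hb
    by_cases h : b < q₁
    · rw [h1L b h]; ring
    · rw [h2L (i - b) (by omega)]; ring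
  · rw [hE]
    have hc : ((i₁ + i₂).choose i₁ : ℝ) ≠ 0 :=
      Nat.cast_ne_zero.mpr (Nat.choose_pos (Nat.le_add_right _ _)).ne'
    exact mul_ne_zero (mul_ne_zero hc h1T) h2T
end

section
/- Let T > 0, let c₁, c₂ > 0, let q₁, q₂ be natural numbers, and let F : ℝ → ℝ be smooth. Define φ(τ) = F(τ)·(ln(c₁τ + 1))^{q₁}·(ln(c₂τ + 1) − ln(c₂T + 1))^{q₂} for τ ∈ [0,T]. Then φ is smooth on an open neighborhood of [0,T], φ^(i)(0) = 0 for all i = 0,…,q₁−1, and φ^(i)(T) = 0 for all i = 0,…,q₂−1. (The logarithmic family of modulating functions.) -/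
lemma iteratedDeriv_mul_pow_zero (g h : ℝ → ℝ) (x : ℝ) (hg : ContDiffAt ℝ (⊤ : ℕ∞) g x)
    (hh : ContDiffAt ℝ (⊤ : ℕ∞) h x) (hx : g x = 0) (q : ℕ) :
    ∀ i < q, iteratedDeriv i (h * g ^ q) x = 0 := by
  induction q with
  | zero => intro i hi; omega
  | succ q ih =>
    intro i hi
    have e : h * g ^ (q + 1) = g * (h * g ^ q) := by ring
    have hi' : ((i : ℕ) : WithTop ℕ∞) ≤ ((⊤ : ℕ∞) : WithTop ℕ∞) := by
      exact_mod_cast (le_top : (i : ℕ∞) ≤ ⊤)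
    have h2 : ContDiffAt ℝ (⊤ : ℕ∞) (h * g ^ q) x := hh.mul (hg.pow q)
    rw [e, iteratedDeriv_mul (hg.of_le hi') (h2.of_le hi')]
    apply Finset.sum_eq_zero
    intro j hj
    rw [Finset.mem_range] at hj
    rcases Nat.eq_zero_or_pos j with rfl | hpos
    · simp [hx]
    · rw [ih (i - j) (by omega), mul_zero]

/-- The logarithmic family of modulating functions: smooth on an open
neighborhood of `[0, T]`, with left order `q₁` and right order `q₂`. -/
theorem logarithmic_family_is_MF
    (T : ℝ) (hT : 0 < T) (c₁ c₂ : ℝ) (hc₁ : 0 < c₁) (hc₂ : 0 < c₂)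
    (q₁ q₂ : ℕ) (F : ℝ → ℝ) (hF : ContDiff ℝ (⊤ : ℕ∞) F) (φ : ℝ → ℝ)
    (hφ : ∀ τ, φ τ = F τ * (Real.log (c₁ * τ + 1)) ^ q₁ *
      (Real.log (c₂ * τ + 1) - Real.log (c₂ * T + 1)) ^ q₂) :
    (∃ U : Set ℝ, IsOpen U ∧ Set.Icc 0 T ⊆ U ∧ ContDiffOn ℝ (⊤ : ℕ∞) φ U) ∧
    (∀ i < q₁, iteratedDeriv i φ 0 = 0) ∧
    (∀ i < q₂, iteratedDeriv i φ T = 0) := by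
  have hlog : ∀ c τ : ℝ, 0 < c * τ + 1 →
      ContDiffAt ℝ (⊤ : ℕ∞) (fun t : ℝ => Real.log (c * t + 1)) τ := by
    intro c τ h
    exact ContDiffAt.log (by fun_prop) h.ne'
  set A : ℝ → ℝ := fun t => Real.log (c₁ * t + 1) with hA
  set B : ℝ → ℝ := fun t => Real.log (c₂ * t + 1) - Real.log (c₂ * T + 1) with hB
  have hAc : ∀ τ, 0 < c₁ * τ + 1 → ContDiffAt ℝ (⊤ : ℕ∞) A τ := fun τ h => hlog c₁ τ h
  have hBc : ∀ τ, 0 < c₂ * τ + 1 → ContDiffAt ℝ (⊤ : ℕ∞) B τ := fun τ h =>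
    (hlog c₂ τ h).sub contDiffAt_const
  have e : φ = F * A ^ q₁ * B ^ q₂ := by
    funext τ
    simp [hφ, hA, hB]
  have e' : φ = F * B ^ q₂ * A ^ q₁ := by rw [e]; ring
  refine ⟨⟨{τ | 0 < c₁ * τ + 1} ∩ {τ | 0 < c₂ * τ + 1}, ?_, ?_, ?_⟩, ?_, ?_⟩
  · exact (isOpen_lt (by fun_prop) (by fun_prop)).inter (isOpen_lt (by fun_prop) (by fun_prop))
  · rintro τ ⟨h0, -⟩
    constructor <;> simp only [Set.mem_setOf_eq] <;> positivity
  · rintro τ ⟨h1, h2⟩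
    rw [e]
    exact ((hF.contDiffAt.mul ((hAc τ h1).pow q₁)).mul ((hBc τ h2).pow q₂)).contDiffWithinAt
  · rw [e']
    exact iteratedDeriv_mul_pow_zero A _ 0 (hAc 0 (by simp))
      (hF.contDiffAt.mul ((hBc 0 (by simp)).pow q₂)) (by simp [hA]) q₁
  · rw [e]
    exact iteratedDeriv_mul_pow_zero B _ T (hBc T (by positivity))
      (hF.contDiffAt.mul ((hAc T (by positivity)).pow q₁)) (by simp [hB]) q₂
end
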